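/- arXiv:1211.4171 — 5 statements merged into one kernel-verified Lean document; each statement's English description precedes it below -/
import Mathlib

section
/- For every natural number m ≥ 2 and all positive real numbers a₁, …, a_m, one has ∑_{i=1}^m 1/aᵢ ≥ (∑_{i=1}^m aᵢ)^{1/(m−1)} · (∏_{i=1}^m 1/aᵢ)^{1/(m−1)}. -/
open Finset

lemma aux_sum_inv (n : ℕ) : ∀ (a : Fin (n+1) → ℝ), (∀ i, 0 < a i) →
    (∑ i, a i) * (∏ i, 1 / a i) ≤ (∑ i, 1 / a i) ^ n := by
  induction n with
  | zero =>
    intro a ha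
    have := (ha 0).ne'
    simp [this]
  | succ n ih =>
    intro a ha
    have h := ih (fun i => a i.succ) (fun i => ha _)
    have hb : ∀ i, 0 < 1 / a i := fun i => one_div_pos.mpr (ha i)
    have hP : (∏ i : Fin (n+1), 1 / a i.succ) ≤ (∑ i : Fin (n+1), 1 / a i.succ) ^ (n+1) := by
      calc (∏ i : Fin (n+1), 1 / a i.succ)
          ≤ ∏ _j : Fin (n+1), (∑ i : Fin (n+1), 1 / a i.succ) :=
            Finset.prod_le_prod (fun i _ => (hb _).le) (fun i _ =>
              Finset.single_le_sum (f := fun i : Fin (n+1) => 1 / a i.succ)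
                (fun j _ => (hb _).le) (Finset.mem_univ i))
        _ = _ := by simp
    have hS : 0 ≤ ∑ i : Fin (n+1), 1 / a i.succ := Finset.sum_nonneg (fun i _ => (hb _).le)
    rw [Fin.sum_univ_succ, Fin.prod_univ_succ, Fin.sum_univ_succ (fun i => 1 / a i)]
    have hy := hb 0
    have hxy : a 0 * (1 / a 0) = 1 := mul_one_div_cancel (ha 0).ne'
    generalize (∑ i : Fin (n+1), 1 / a i.succ) = S at *
    generalize (∏ i : Fin (n+1), 1 / a i.succ) = P at *
    generalize (∑ i : Fin (n+1), a i.succ) = A at *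
    generalize 1 / a 0 = y at *
    calc (a 0 + A) * (y * P) = (a 0 * y) * P + y * (A * P) := by ring
      _ ≤ S ^ (n+1) + y * S ^ n := by
        rw [hxy, one_mul]
        exact add_le_add hP (mul_le_mul_of_nonneg_left h hy.le)
      _ = S ^ n * (y + S) := by ring
      _ ≤ (y + S) ^ n * (y + S) := by
        gcongr
        linarith
      _ = (y + S) ^ (n+1) := by ring

/-- For every natural number `m ≥ 2` and positive reals `a₁, …, a_m`,
`∑ 1/aᵢ ≥ (∑ aᵢ)^(1/(m-1)) * (∏ 1/aᵢ)^(1/(m-1))`, with real-power exponents. -/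
theorem sum_inv_ge_rpow_mul_rpow (m : ℕ) (hm : 2 ≤ m) (a : Fin m → ℝ)
    (ha : ∀ i, 0 < a i) :
    (∑ i, 1 / a i) ≥
      (∑ i, a i) ^ ((1 : ℝ) / ((m : ℝ) - 1)) *
        (∏ i, 1 / a i) ^ ((1 : ℝ) / ((m : ℝ) - 1)) := by
  obtain ⟨n, rfl⟩ : ∃ n, m = n + 1 := ⟨m - 1, by omega⟩
  have hn : n ≠ 0 := by omega
  have h := aux_sum_inv n a ha
  have hb : ∀ i, 0 < 1 / a i := fun i => one_div_pos.mpr (ha i)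
  have hA : 0 ≤ ∑ i, a i := Finset.sum_nonneg (fun i _ => (ha i).le)
  have hP : 0 ≤ ∏ i, 1 / a i := Finset.prod_nonneg (fun i _ => (hb i).le)
  have hS : 0 ≤ ∑ i, 1 / a i := Finset.sum_nonneg (fun i _ => (hb i).le)
  have e : (1 : ℝ) / (((n + 1 : ℕ) : ℝ) - 1) = (n : ℝ)⁻¹ := by
    push_cast
    rw [add_sub_cancel_right, one_div]
  rw [ge_iff_le, e, ← Real.mul_rpow hA hP]
  calc _ ≤ ((∑ i, 1 / a i) ^ n) ^ ((n : ℝ)⁻¹) :=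
        Real.rpow_le_rpow (mul_nonneg hA hP) h (by positivity)
    _ = _ := Real.pow_rpow_inv_natCast hS hn
end

section
/- Let (X, μ) be a measure space with μ a finite measure, let f : X → ℝ be (a.e.-strongly) measurable, let γ > 1 and C ≥ 1 be real constants, and suppose that for every natural number j, ‖f‖_{L^{γ^{j+1}}(μ)} ≤ (C·γ^j)^{γ^{−j}} · ‖f‖_{L^{γ^j}(μ)}. Then the essential supremum norm satisfies ‖f‖_{L^∞(μ)} ≤ C^{γ/(γ−1)} · γ^{γ/(γ−1)²} · ‖f‖_{L^1(μ)}. -/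
open MeasureTheory

/-- Nash–Moser iteration: on a finite measure space, if for every `j`
`‖f‖_{L^{γ^{j+1}}} ≤ (C·γ^j)^{γ^{-j}} · ‖f‖_{L^{γ^j}}` (with `γ > 1`, `C ≥ 1`),
then `‖f‖_{L^∞} ≤ C^{γ/(γ-1)} · γ^{γ/(γ-1)²} · ‖f‖_{L^1}`. -/
theorem nash_moser_iteration {X : Type*} [MeasurableSpace X]
    (μ : Measure X) [IsFiniteMeasure μ] (f : X → ℝ)
    (hf : AEStronglyMeasurable f μ)
    (γ C : ℝ) (hγ : 1 < γ) (hC : 1 ≤ C)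
    (hiter : ∀ j : ℕ,
      eLpNorm f (ENNReal.ofReal (γ ^ (j + 1))) μ ≤
        ENNReal.ofReal ((C * γ ^ j) ^ (γ ^ (-(j : ℝ)))) *
          eLpNorm f (ENNReal.ofReal (γ ^ j)) μ) :
    eLpNorm f ⊤ μ ≤
      ENNReal.ofReal (C ^ (γ / (γ - 1)) * γ ^ (γ / (γ - 1) ^ 2)) *
        eLpNorm f 1 μ := by
  have hγ0 : 0 < γ := by linarith
  have hC0 : 0 < C := by linarith
  have hr0 : 0 ≤ γ⁻¹ := by positivity
  have hr1 : γ⁻¹ < 1 := inv_lt_one_of_one_lt₀ hγ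
  have hg1 : γ - 1 ≠ 0 := by linarith
  have hS : ∀ j : ℕ, ∑ i ∈ Finset.range j, γ⁻¹ ^ i ≤ γ / (γ - 1) := by
    intro j
    have h := sum_le_hasSum (Finset.range j) (fun i _ => by positivity)
      (hasSum_geometric_of_lt_one hr0 hr1)
    have e : (1 - γ⁻¹)⁻¹ = γ / (γ - 1) := by
      rw [← inv_div]
      congr 1
      field_simp
    rwa [e] at h
  have hT : ∀ j : ℕ, ∑ i ∈ Finset.range j, (i : ℝ) * γ⁻¹ ^ i ≤ γ / (γ - 1) ^ 2 := by
    intro j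
    have h := sum_le_hasSum (Finset.range j) (fun i _ => by positivity)
      (hasSum_coe_mul_geometric_of_norm_lt_one (𝕜 := ℝ) (r := γ⁻¹)
        (by rwa [Real.norm_of_nonneg hr0]))
    have e : γ⁻¹ / (1 - γ⁻¹) ^ 2 = γ / (γ - 1) ^ 2 := by
      have : 1 - γ⁻¹ = (γ - 1) / γ := by field_simp
      rw [this]
      field_simp
    rwa [e] at h
  have hstep : ∀ j : ℕ, (C * γ ^ j) ^ (γ ^ (-(j : ℝ))) =
      C ^ (γ⁻¹ ^ j) * γ ^ ((j : ℝ) * γ⁻¹ ^ j) := by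
    intro j
    have e : γ ^ (-(j : ℝ)) = γ⁻¹ ^ j := by
      rw [Real.rpow_neg hγ0.le, Real.rpow_natCast, inv_pow]
    rw [e, Real.mul_rpow hC0.le (by positivity), Real.rpow_mul hγ0.le, Real.rpow_natCast]
  have hind : ∀ j : ℕ, eLpNorm f (ENNReal.ofReal (γ ^ j)) μ ≤
      ENNReal.ofReal (C ^ (∑ i ∈ Finset.range j, γ⁻¹ ^ i) *
        γ ^ (∑ i ∈ Finset.range j, (i : ℝ) * γ⁻¹ ^ i)) * eLpNorm f 1 μ := by
    intro j
    induction j with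
    | zero => simp
    | succ j ih =>
      refine (hiter j).trans ((mul_le_mul_right ih _).trans (le_of_eq ?_))
      rw [← mul_assoc, ← ENNReal.ofReal_mul (by positivity), hstep, Finset.sum_range_succ,
        Finset.sum_range_succ, Real.rpow_add hC0, Real.rpow_add hγ0]
      congr 2
      ring
  set M := ENNReal.ofReal (C ^ (γ / (γ - 1)) * γ ^ (γ / (γ - 1) ^ 2)) * eLpNorm f 1 μ with hM
  have hbd : ∀ j : ℕ, eLpNorm f (ENNReal.ofReal (γ ^ j)) μ ≤ M := by
    intro j
    refine (hind j).trans ?_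
    rw [hM]
    gcongr
    · exact hS j
    · exact hγ.le
    · exact hT j
  by_contra hlt
  rw [not_le] at hlt
  obtain ⟨ε, hε1, hε2⟩ := exists_between hlt
  have hε0 : ε ≠ 0 := (bot_le.trans_lt hε1).ne'
  have hεt : ε ≠ ⊤ := (hε2.trans_le le_top).ne
  have hq : M / ε < 1 := by
    rw [ENNReal.div_lt_iff (Or.inl hε0) (Or.inl hεt)]
    simpa using hε1
  have hle : ∀ j : ℕ, μ {x | ε ≤ ‖f x‖ₑ} ≤ (M / ε) ^ j := by
    intro j
    obtain ⟨k, hk⟩ := pow_unbounded_of_one_lt (j : ℝ) hγ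
    have hp : 0 < γ ^ k := by positivity
    have h := meas_ge_le_mul_pow_eLpNorm_enorm μ (p := ENNReal.ofReal (γ ^ k))
      (by simpa using hp) ENNReal.ofReal_ne_top hf hε0 (fun h => absurd h hεt)
    rw [ENNReal.toReal_ofReal hp.le] at h
    refine h.trans ?_
    rw [← ENNReal.mul_rpow_of_nonneg _ _ hp.le]
    calc (ε⁻¹ * eLpNorm f (ENNReal.ofReal (γ ^ k)) μ) ^ (γ ^ k)
        ≤ (M / ε) ^ (γ ^ k) := by
          rw [div_eq_mul_inv, mul_comm M]
          gcongr
          exact hbd k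
      _ ≤ (M / ε) ^ (j : ℝ) := ENNReal.rpow_le_rpow_of_exponent_ge hq.le hk.le
      _ = (M / ε) ^ j := ENNReal.rpow_natCast _ _
  have hz : μ {x | ε ≤ ‖f x‖ₑ} = 0 := by
    refine le_antisymm ?_ bot_le
    exact ge_of_tendsto' (ENNReal.tendsto_pow_atTop_nhds_zero_of_lt_one hq) hle
  refine hε2.not_ge ?_
  rw [eLpNorm_exponent_top]
  refine essSup_le_of_ae_le _ ?_
  have : ∀ᵐ x ∂μ, ¬ ε ≤ ‖f x‖ₑ := by
    rw [ae_iff]; simpa using hz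
  filter_upwards [this] with x hx
  exact (not_le.mp hx).le
end

section
/- Strong maximum principle, c ≡ 0: Let Ω ⊆ E = EuclideanSpace ℝ (Fin n) be a nonempty bounded open connected set, let u : E → ℝ be continuous on the closure of Ω and C² on Ω with data (Du, D²u), let the coefficients a, b (with c ≡ 0) be bounded on Ω, and let L be uniformly elliptic on Ω. Suppose Lu(x) = ∑ᵢⱼ aᵢⱼ(x)∂ᵢ∂ⱼu(x) + ∑ᵢ bᵢ(x)∂ᵢu(x) = 0 for all x ∈ Ω. If u attains its maximum over the closure of Ω at some interior point, i.e. there exists x₀ ∈ Ω with u(x) ≤ u(x₀) for all x in the closure of Ω, then u is constant on Ω. -/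
open Set

open scoped MatrixOrder Matrix.Norms.L2Operator in
lemma smp_trace {n : ℕ} (A H : Fin n → Fin n → ℝ)
    (hA : ∀ ξ : EuclideanSpace ℝ (Fin n), 0 ≤ ∑ i, ∑ j, A i j * ξ i * ξ j)
    (hs : ∀ i j, H i j = H j i)
    (hH : ∀ ξ : Fin n → ℝ, ∑ i, ∑ j, H i j * ξ i * ξ j ≤ 0) :
    ∑ i, ∑ j, A i j * H i j ≤ 0 := by
  have hP : (Matrix.of (fun i j => - H i j)).PosSemidef := by
    refine Matrix.PosSemidef.of_dotProduct_mulVec_nonneg ?_ ?_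
    · ext i j
      simp [hs i j]
    · intro x
      have := hH x
      have h2 : star x ⬝ᵥ (Matrix.of (fun i j => - H i j)).mulVec x
          = - ∑ i, ∑ j, H i j * x i * x j := by
        simp only [dotProduct, Matrix.mulVec, Finset.mul_sum, ← Finset.sum_neg_distrib]
        refine Finset.sum_congr rfl fun i _ => Finset.sum_congr rfl fun j _ => ?_
        simp
        ring
      rw [h2]; linarith
  obtain ⟨B, hB⟩ := CStarAlgebra.nonneg_iff_eq_star_mul_self.mp hP.nonneg
  have hBe : ∀ i j, H i j = - ∑ k, B k i * B k j := by
    intro i j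
    have := congrFun (congrFun hB i) j
    simp [Matrix.mul_apply] at this
    linarith
  have h1 : ∑ i, ∑ j, A i j * H i j = - ∑ k, ∑ i, ∑ j, A i j * B k i * B k j := by
    rw [Finset.sum_comm (s := Finset.univ (α := Fin n)) (t := Finset.univ (α := Fin n)) (f := fun k i => ∑ j, A i j * B k i * B k j), ← Finset.sum_neg_distrib]
    refine Finset.sum_congr rfl fun i _ => ?_
    rw [Finset.sum_comm, ← Finset.sum_neg_distrib]
    refine Finset.sum_congr rfl fun j _ => ?_
    rw [hBe, mul_neg, Finset.mul_sum]
    congr 1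
    refine Finset.sum_congr rfl fun k _ => by ring
  rw [h1, neg_nonpos]
  refine Finset.sum_nonneg fun k _ => ?_
  exact hA (WithLp.toLp 2 (B k))

lemma smp_oned (f g : ℝ → ℝ) (s : ℝ) (hf : ∀ᶠ t in nhds 0, HasDerivAt f (g t) t)
    (hg : HasDerivAt g s 0) (hm : IsLocalMax f 0) : s ≤ 0 := by
  by_contra! hs
  have h0 : g 0 = 0 := hm.hasDerivAt_eq_zero hf.self_of_nhds
  have hd : deriv f =ᶠ[nhds 0] g := hf.mono fun t ht => ht.deriv
  have hdd : deriv (deriv f) 0 = s := by rw [hd.deriv_eq, hg.deriv]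
  have hmin : IsLocalMin f 0 := isLocalMin_of_deriv_deriv_pos (by rw [hdd]; exact hs)
    (by rw [hd.self_of_nhds, h0]) hf.self_of_nhds.continuousAt
  have hc : ∀ᶠ t in nhds 0, f t = f 0 := by
    filter_upwards [hm, hmin] with t h1 h2 using le_antisymm h1 h2
  have h3 : deriv f =ᶠ[nhds 0] deriv (fun _ => f 0) := Filter.EventuallyEq.deriv hc
  have h4 := h3.deriv_eq
  simp at h4
  linarith

lemma smp_local (n : ℕ)
    (Ω : Set (EuclideanSpace ℝ (Fin n))) (hΩopen : IsOpen Ω)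
    (u : EuclideanSpace ℝ (Fin n) → ℝ)
    (Du : EuclideanSpace ℝ (Fin n) → (EuclideanSpace ℝ (Fin n) →L[ℝ] ℝ))
    (D2u : EuclideanSpace ℝ (Fin n) →
      (EuclideanSpace ℝ (Fin n) →L[ℝ] (EuclideanSpace ℝ (Fin n) →L[ℝ] ℝ)))
    (hDu : ∀ x ∈ Ω, HasFDerivAt u (Du x) x)
    (hD2u : ∀ x ∈ Ω, HasFDerivAt Du (D2u x) x)
    (a : Fin n → Fin n → EuclideanSpace ℝ (Fin n) → ℝ)
    (b : Fin n → EuclideanSpace ℝ (Fin n) → ℝ)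
    (K : ℝ) (hK : 0 < K)
    (ha_bd : ∀ i j, ∀ x ∈ Ω, |a i j x| ≤ K)
    (hb_bd : ∀ i, ∀ x ∈ Ω, |b i x| ≤ K)
    (lam : ℝ) (hlam : 0 < lam)
    (hell : ∀ x ∈ Ω, ∀ ξ : EuclideanSpace ℝ (Fin n),
      lam * ‖ξ‖ ^ 2 ≤ ∑ i, ∑ j, a i j x * ξ i * ξ j)
    (hLu : ∀ x ∈ Ω,
      (∑ i, ∑ j, a i j x *
          D2u x (EuclideanSpace.single i 1) (EuclideanSpace.single j 1)) +
        (∑ i, b i x * Du x (EuclideanSpace.single i 1)) = 0)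
    (p y : EuclideanSpace ℝ (Fin n)) (hp : p ∈ Ω) (ε α : ℝ) (hε : 0 < ε) (hα : 0 < α)
    (hmax : IsLocalMax (fun x => u x + ε * Real.exp (-α * ‖x - y‖ ^ 2)) p) :
    2 * α * lam * ‖p - y‖ ^ 2 ≤ n * K * (1 + ‖p - y‖) := by
  set q := p - y with hq
  set c := ε * Real.exp (-α * ‖q‖ ^ 2) with hc
  have hcpos : 0 < c := by positivity
  -- lines
  have hline : ∀ ξ : EuclideanSpace ℝ (Fin n), ∀ t : ℝ, HasDerivAt (fun t : ℝ => p + t • ξ) ξ t := by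
    intro ξ t
    simpa using ((hasDerivAt_id t).smul_const ξ).const_add p
  have hev : ∀ ξ : EuclideanSpace ℝ (Fin n), ∀ᶠ t : ℝ in nhds 0, p + t • ξ ∈ Ω := by
    intro ξ
    have h1 : ContinuousAt (fun t : ℝ => p + t • ξ) 0 := (hline ξ 0).continuousAt
    exact h1.eventually_mem (hΩopen.mem_nhds (by simpa using hp))
  have hQ : ∀ ξ : EuclideanSpace ℝ (Fin n), ∀ t : ℝ,
      ‖p + t • ξ - y‖ ^ 2 = ‖q‖ ^ 2 + 2 * t * inner ℝ q ξ + t ^ 2 * ‖ξ‖ ^ 2 := by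
    intro ξ t
    have : p + t • ξ - y = q + t • ξ := by rw [hq]; abel
    rw [this, norm_add_sq_real, inner_smul_right, norm_smul, mul_pow]
    simp; ring
  have hE : ∀ ξ : EuclideanSpace ℝ (Fin n), ∀ t : ℝ,
      HasDerivAt (fun t : ℝ => ε * Real.exp (-α * ‖p + t • ξ - y‖ ^ 2))
        (ε * (Real.exp (-α * ‖p + t • ξ - y‖ ^ 2) * (-α * (2 * inner ℝ q ξ + 2 * t * ‖ξ‖ ^ 2)))) t := by
    intro ξ t
    simp only [hQ]
    have h1 : HasDerivAt (fun t : ℝ => ‖q‖ ^ 2 + 2 * t * inner ℝ q ξ + t ^ 2 * ‖ξ‖ ^ 2)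
        (2 * inner ℝ q ξ + 2 * t * ‖ξ‖ ^ 2) t := by
      have := ((((hasDerivAt_id t).const_mul 2).mul_const (inner ℝ q ξ)).const_add (‖q‖ ^ 2)).add
        (((hasDerivAt_id t).pow 2).mul_const (‖ξ‖ ^ 2))
      refine (this.congr_deriv ?_).congr_of_eventuallyEq (Filter.Eventually.of_forall fun x => ?_)
      · simp
      · simp
    exact ((h1.const_mul (-α)).exp).const_mul ε
  have hU : ∀ ξ : EuclideanSpace ℝ (Fin n), ∀ᶠ t : ℝ in nhds 0,
      HasDerivAt (fun t : ℝ => u (p + t • ξ)) (Du (p + t • ξ) ξ) t := by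
    intro ξ
    filter_upwards [hev ξ] with t ht
    exact (hDu _ ht).comp_hasDerivAt t (hline ξ t)
  have hU2 : ∀ ξ : EuclideanSpace ℝ (Fin n),
      HasDerivAt (fun t : ℝ => Du (p + t • ξ) ξ) (D2u p ξ ξ) 0 := by
    intro ξ
    have h1 : HasFDerivAt Du (D2u p) (p + (0:ℝ) • ξ) := by simpa using hD2u p hp
    have h2 := h1.comp_hasDerivAt 0 (hline ξ 0)
    simpa using h2.clm_apply (hasDerivAt_const (0:ℝ) ξ)
  have hL : ∀ ξ : EuclideanSpace ℝ (Fin n),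
      IsLocalMax (fun t : ℝ => u (p + t • ξ) + ε * Real.exp (-α * ‖p + t • ξ - y‖ ^ 2)) 0 := by
    intro ξ
    have h1 : ContinuousAt (fun t : ℝ => p + t • ξ) 0 := (hline ξ 0).continuousAt
    have h2 : Filter.Tendsto (fun t : ℝ => p + t • ξ) (nhds 0) (nhds p) := by
      simpa [ContinuousAt] using h1
    have := h2.eventually hmax
    filter_upwards [this] with t ht
    simpa using ht
  have hgrad : ∀ ξ : EuclideanSpace ℝ (Fin n), Du p ξ = 2 * α * c * inner ℝ q ξ := by
    intro ξ
    have h := (hL ξ).hasDerivAt_eq_zero ((hU ξ).self_of_nhds.add (hE ξ 0))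
    simp only [zero_smul, add_zero, ← hq, mul_zero, zero_mul] at h
    rw [hc]; linear_combination h
  have hhess : ∀ ξ : EuclideanSpace ℝ (Fin n),
      D2u p ξ ξ + c * (4 * α ^ 2 * inner ℝ q ξ ^ 2 - 2 * α * ‖ξ‖ ^ 2) ≤ 0 := by
    intro ξ
    refine smp_oned _ (fun t => Du (p + t • ξ) ξ + (ε * Real.exp (-α * ‖p + t • ξ - y‖ ^ 2)) *
      (-α * (2 * inner ℝ q ξ + 2 * t * ‖ξ‖ ^ 2))) _ ?_ ?_ (hL ξ)
    · filter_upwards [hU ξ] with t ht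
      refine (ht.add (hE ξ t)).congr_deriv ?_
      ring
    · have h1 : HasDerivAt (fun t : ℝ => -α * (2 * inner ℝ q ξ + 2 * t * ‖ξ‖ ^ 2))
          (-α * (2 * ‖ξ‖ ^ 2)) 0 := by
        have := ((((hasDerivAt_id (0:ℝ)).const_mul 2).mul_const (‖ξ‖ ^ 2)).const_add
          (2 * inner ℝ q ξ)).const_mul (-α)
        simpa using this
      have h2 := (hU2 ξ).add ((hE ξ 0).mul h1)
      refine h2.congr_deriv ?_
      simp only [zero_smul, add_zero, ← hq, mul_zero, zero_mul]
      rw [hc]; ring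
  have hsymm : ∀ v w, D2u p v w = D2u p w v := by
    intro v w
    exact second_derivative_symmetric_of_eventually
      (Filter.eventually_of_mem (hΩopen.mem_nhds hp) hDu) (hD2u p hp) v w
  have hin : ∀ i, inner ℝ q (EuclideanSpace.single i (1:ℝ)) = q i := by
    intro i; simp [EuclideanSpace.inner_single_right]
  have htr := smp_trace (fun i j => a i j p)
    (fun i j => D2u p (EuclideanSpace.single i 1) (EuclideanSpace.single j 1) +
      c * (4 * α ^ 2 * (q i * q j) - 2 * α * (if i = j then 1 else 0)))
    (fun ξ => le_trans (by positivity) (hell p hp ξ))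
    (by
      intro i j
      rw [hsymm, mul_comm (q i)]
      simp only [eq_comm (a := i) (b := j)])
    (by
      intro ξ
      have hx : (WithLp.toLp 2 ξ : EuclideanSpace ℝ (Fin n)) =
          ∑ i, ξ i • EuclideanSpace.single i (1:ℝ) := by
        have := (EuclideanSpace.basisFun (Fin n) ℝ).sum_repr (WithLp.toLp 2 ξ)
        simpa using this.symm
      have h := hhess (WithLp.toLp 2 ξ)
      have h1 : D2u p (WithLp.toLp 2 ξ) (WithLp.toLp 2 ξ) =
          ∑ i, ∑ j, D2u p (EuclideanSpace.single i 1) (EuclideanSpace.single j 1) * ξ i * ξ j := by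
        rw [hx]
        simp only [map_sum, map_smul, sum_apply, smul_apply,
          smul_eq_mul, Finset.mul_sum]
        rw [Finset.sum_comm]
        refine Finset.sum_congr rfl fun i _ => Finset.sum_congr rfl fun j _ => by ring
      have h2 : (inner ℝ q (WithLp.toLp 2 ξ) : ℝ) ^ 2 = ∑ i, ∑ j, q i * q j * ξ i * ξ j := by
        rw [sq, PiLp.inner_apply, Finset.sum_mul_sum]
        refine Finset.sum_congr rfl fun i _ => Finset.sum_congr rfl fun j _ => ?_
        simp; ring
      have h3 : ‖(WithLp.toLp 2 ξ : EuclideanSpace ℝ (Fin n))‖ ^ 2 =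
          ∑ i, ∑ j, (if i = j then (1:ℝ) else 0) * ξ i * ξ j := by
        rw [EuclideanSpace.norm_sq_eq]
        simp [sq]
      rw [h1, h2, h3] at h
      refine le_trans (le_of_eq ?_) h
      simp only [Finset.mul_sum, ← Finset.sum_sub_distrib, ← Finset.sum_add_distrib]
      refine Finset.sum_congr rfl fun i _ => Finset.sum_congr rfl fun j _ => by ring)
  have hexp : ∑ i, ∑ j, a i j p * (D2u p (EuclideanSpace.single i 1) (EuclideanSpace.single j 1) +
      c * (4 * α ^ 2 * (q i * q j) - 2 * α * (if i = j then 1 else 0))) =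
      (∑ i, ∑ j, a i j p * D2u p (EuclideanSpace.single i 1) (EuclideanSpace.single j 1)) +
      c * (4 * α ^ 2 * (∑ i, ∑ j, a i j p * q i * q j) - 2 * α * ∑ i, a i i p) := by
    have : ∑ i, a i i p = ∑ i, ∑ j, a i j p * (if i = j then 1 else 0) := by simp
    rw [this]
    simp only [Finset.mul_sum, ← Finset.sum_sub_distrib, ← Finset.sum_add_distrib]
    refine Finset.sum_congr rfl fun i _ => Finset.sum_congr rfl fun j _ => by ring
  rw [hexp] at htr
  have hb : ∑ i, b i p * Du p (EuclideanSpace.single i 1) = 2 * α * c * ∑ i, b i p * q i := by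
    rw [Finset.mul_sum]
    refine Finset.sum_congr rfl fun i _ => ?_
    rw [hgrad, hin]; ring
  have hl := hLu p hp
  rw [hb] at hl
  have hbb : ∑ i, b i p * q i ≤ n * K * ‖q‖ := by
    calc ∑ i, b i p * q i ≤ ∑ i : Fin n, K * ‖q‖ := by
          refine Finset.sum_le_sum fun i _ => ?_
          refine le_trans (le_abs_self _) ?_
          rw [abs_mul]
          exact mul_le_mul (hb_bd i p hp) (PiLp.norm_apply_le q i) (abs_nonneg _) hK.le
      _ = n * K * ‖q‖ := by simp; ring
  have haa : ∑ i, a i i p ≤ n * K := by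
    calc ∑ i, a i i p ≤ ∑ i : Fin n, K :=
          Finset.sum_le_sum fun i _ => le_trans (le_abs_self _) (ha_bd i i p hp)
      _ = n * K := by simp
  have he := hell p hp q
  set Q := ∑ i, ∑ j, a i j p * q i * q j
  have hfin : (2 * α * c) * (2 * α * Q - ∑ i, a i i p - ∑ i, b i p * q i) ≤ 0 := by
    linarith
  have hfin2 : 2 * α * Q - ∑ i, a i i p - ∑ i, b i p * q i ≤ 0 := by
    by_contra! h
    have : 0 < (2 * α * c) * (2 * α * Q - ∑ i, a i i p - ∑ i, b i p * q i) := by positivity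
    linarith
  have : 2 * α * (lam * ‖q‖ ^ 2) ≤ 2 * α * Q := mul_le_mul_of_nonneg_left he (by positivity)
  linarith

/-- Strong maximum principle, `c ≡ 0`: if `Lu = ∑ aᵢⱼ ∂ᵢ∂ⱼu + ∑ bᵢ ∂ᵢu = 0` on
a nonempty bounded open connected set `Ω`, with `L` uniformly elliptic and
bounded coefficients, `u` continuous on `closure Ω` and `C²` on `Ω`, and `u`
attains its maximum over `closure Ω` at an interior point, then `u` is constant
on `Ω`. -/
theorem strong_maximum_principle_elliptic (n : ℕ)
    (Ω : Set (EuclideanSpace ℝ (Fin n)))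
    (hΩconn : IsConnected Ω) (hΩopen : IsOpen Ω) (hΩbd : Bornology.IsBounded Ω)
    (u : EuclideanSpace ℝ (Fin n) → ℝ)
    (Du : EuclideanSpace ℝ (Fin n) → (EuclideanSpace ℝ (Fin n) →L[ℝ] ℝ))
    (D2u : EuclideanSpace ℝ (Fin n) →
      (EuclideanSpace ℝ (Fin n) →L[ℝ] (EuclideanSpace ℝ (Fin n) →L[ℝ] ℝ)))
    (hu_cont : ContinuousOn u (closure Ω))
    (hDu : ∀ x ∈ Ω, HasFDerivAt u (Du x) x)
    (hD2u : ∀ x ∈ Ω, HasFDerivAt Du (D2u x) x)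
    (a : Fin n → Fin n → EuclideanSpace ℝ (Fin n) → ℝ)
    (b : Fin n → EuclideanSpace ℝ (Fin n) → ℝ)
    (K : ℝ) (hK : 0 < K)
    (ha_bd : ∀ i j, ∀ x ∈ Ω, |a i j x| ≤ K)
    (hb_bd : ∀ i, ∀ x ∈ Ω, |b i x| ≤ K)
    (lam : ℝ) (hlam : 0 < lam)
    (hell : ∀ x ∈ Ω, ∀ ξ : EuclideanSpace ℝ (Fin n),
      lam * ‖ξ‖ ^ 2 ≤ ∑ i, ∑ j, a i j x * ξ i * ξ j)
    (hLu : ∀ x ∈ Ω,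
      (∑ i, ∑ j, a i j x *
          D2u x (EuclideanSpace.single i 1) (EuclideanSpace.single j 1)) +
        (∑ i, b i x * Du x (EuclideanSpace.single i 1)) = 0)
    (x₀ : EuclideanSpace ℝ (Fin n)) (hx₀ : x₀ ∈ Ω)
    (hmax : ∀ x ∈ closure Ω, u x ≤ u x₀) :
    ∀ x ∈ Ω, u x = u x₀ := by
  set M := u x₀ with hM
  have hle : ∀ x ∈ Ω, u x ≤ M := fun x hx => hmax x (subset_closure hx)
  have huc : ContinuousOn u Ω := hu_cont.mono subset_closure
  suffices hsub : Ω ⊆ {x | x ∈ Ω ∧ u x = M} from fun x hx => (hsub hx).2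
  refine hΩconn.isPreconnected.subset_of_closure_inter_subset ?_ ⟨x₀, hx₀, hx₀, rfl⟩ ?_
  swap
  · rintro x ⟨hxc, hx⟩
    refine ⟨hx, ?_⟩
    by_contra hne
    have hc : ContinuousAt u x := huc.continuousAt (hΩopen.mem_nhds hx)
    have h1 : {z | u z ≠ M} ∈ nhds x := hc.eventually_ne hne
    obtain ⟨z, hz1, hz2⟩ := mem_closure_iff_nhds.1 hxc _ h1
    exact hz1 hz2.2
  rw [Metric.isOpen_iff]
  rintro x₁ ⟨hx₁, hux₁⟩
  obtain ⟨s, hs, hsΩ⟩ := Metric.isOpen_iff.1 hΩopen x₁ hx₁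
  -- radius
  set r := s / 4 with hr
  have hrpos : 0 < r := by positivity
  have h2r : Metric.closedBall x₁ (2 * r) ⊆ Ω :=
    (Metric.closedBall_subset_ball (by rw [hr]; linarith)).trans hsΩ
  refine ⟨r, hrpos, ?_⟩
  intro y hy
  rw [Metric.mem_ball] at hy
  have hyΩ : y ∈ Ω := h2r (Metric.mem_closedBall.2 (by linarith))
  refine ⟨hyΩ, ?_⟩
  by_contra hne
  -- closest point
  have hScomp : IsCompact (Metric.closedBall x₁ (2 * r) ∩ {x | u x = M}) := by
    have h1 : IsClosed (Metric.closedBall x₁ (2 * r) ∩ u ⁻¹' {M}) :=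
      (huc.mono h2r).preimage_isClosed_of_isClosed Metric.isClosed_closedBall isClosed_singleton
    exact (isCompact_closedBall x₁ (2 * r)).of_isClosed_subset h1 inter_subset_left
  obtain ⟨z, ⟨hzb, hzM⟩, hzmin⟩ := hScomp.exists_isMinOn
    ⟨x₁, Metric.mem_closedBall_self (by positivity), hux₁⟩
    (f := fun x => dist x y) (by fun_prop)
  have hzM' : u z = M := hzM
  have hzx₁ : dist z y ≤ dist x₁ y :=
    hzmin ⟨Metric.mem_closedBall_self (by positivity), hux₁⟩
  have hzy : z ≠ y := by
    rintro rfl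
    exact hne hzM
  have hRpos : 0 < dist z y := dist_pos.2 hzy
  have hzΩ : z ∈ Ω := h2r hzb
  set y' := y + (1 / 2 : ℝ) • (z - y) with hy'
  set R := dist z y / 2 with hR
  have hR0 : 0 < R := by positivity
  have hzy' : ‖z - y'‖ = R := by
    have : z - y' = (1 / 2 : ℝ) • (z - y) := by
      rw [hy']; module
    rw [this, norm_smul, hR, dist_eq_norm]
    simp; ring
  -- touching only at z
  have htouch : ∀ x, ‖x - y'‖ ≤ R → x ≠ z → x ∈ Ω ∧ u x < M := by
    intro x hx hxz
    have hyy : ‖y' - y‖ = R := by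
      have : y' - y = (1 / 2 : ℝ) • (z - y) := by rw [hy']; module
      rw [this, norm_smul, hR, dist_eq_norm]
      simp; ring
    have hxy : ‖x - y‖ ≤ dist z y := by
      have := norm_sub_le_norm_sub_add_norm_sub x y' y
      rw [hyy] at this
      rw [hR] at *
      linarith
    have hxb : x ∈ Metric.closedBall x₁ (2 * r) := by
      rw [Metric.mem_closedBall]
      have := dist_triangle x y x₁
      rw [dist_eq_norm x y] at this
      rw [dist_comm x₁ y] at hzx₁
      linarith
    refine ⟨h2r hxb, lt_of_le_of_ne (hle x (h2r hxb)) ?_⟩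
    intro hxM
    have h1 : dist z y ≤ dist x y := hzmin ⟨hxb, hxM⟩
    rw [dist_eq_norm, dist_eq_norm] at h1
    apply hxz
    have e1 : x - y' = (x - y) - (1 / 2 : ℝ) • (z - y) := by rw [hy']; module
    have h2 : ‖x - y'‖ ^ 2 ≤ R ^ 2 := by gcongr
    rw [e1, norm_sub_sq_real, inner_smul_right, norm_smul, hR, dist_eq_norm] at h2
    have h3 : ‖(x - y) - (z - y)‖ ^ 2 = _ := norm_sub_sq_real (x - y) (z - y)
    have h4 : ‖z - y‖ ^ 2 ≤ ‖x - y‖ ^ 2 := by gcongr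
    have h5 : ‖(1 / 2 : ℝ)‖ = 1 / 2 := by norm_num
    rw [h5] at h2
    have h6 : ‖(x - y) - (z - y)‖ ^ 2 ≤ 0 := by
      rw [h3]; nlinarith
    have h7 : (x - y) - (z - y) = 0 := by
      rw [← norm_eq_zero]
      exact pow_eq_zero_iff (two_ne_zero) |>.1 (le_antisymm h6 (by positivity))
    rw [sub_sub_sub_cancel_right] at h7
    exact sub_eq_zero.1 h7
  -- small ball about z
  obtain ⟨s', hs', hs'Ω⟩ := Metric.isOpen_iff.1 hΩopen z hzΩ
  obtain ⟨ρ, hρ, hρR, hρs⟩ : ∃ ρ, 0 < ρ ∧ ρ ≤ R / 2 ∧ ρ < s' :=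
    ⟨min (R / 2) (s' / 2), by positivity, min_le_left _ _,
      lt_of_le_of_lt (min_le_right _ _) (by linarith)⟩
  have hρΩ : Metric.closedBall z ρ ⊆ Ω := (Metric.closedBall_subset_ball hρs).trans hs'Ω
  obtain ⟨ε, hε, hεT⟩ : ∃ ε > 0, ∀ x, dist x z = ρ → ‖x - y'‖ ≤ R → u x + ε ≤ M := by
    have hT : IsCompact (Metric.sphere z ρ ∩ Metric.closedBall y' R) :=
      (isCompact_sphere z ρ).inter_right Metric.isClosed_closedBall
    by_cases hne' : (Metric.sphere z ρ ∩ Metric.closedBall y' R).Nonempty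
    · obtain ⟨t, ⟨ht1, ht2⟩, htm⟩ := hT.exists_isMaxOn hne'
        (huc.mono (inter_subset_left.trans (Metric.sphere_subset_closedBall.trans hρΩ)))
      have hlt := (htouch t (by simpa [dist_eq_norm] using ht2) (by
        rintro rfl
        simp at ht1
        linarith)).2
      refine ⟨M - u t, by linarith, fun x hx hx2 => ?_⟩
      have : u x ≤ u t := htm ⟨hx, by simpa [dist_eq_norm] using hx2⟩
      linarith
    · refine ⟨1, one_pos, fun x hx hx2 => ?_⟩
      exact absurd ⟨x, hx, by simpa [dist_eq_norm] using hx2⟩ hne'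
  set α := (n * K * (1 + 2 * R) + 1) / (2 * lam * (R / 2) ^ 2) with hα
  have hα0 : 0 < α := by positivity
  set w := fun x => u x + ε * Real.exp (-α * ‖x - y'‖ ^ 2) with hw
  have hwc : ContinuousOn w (Metric.closedBall z ρ) := by
    refine (huc.mono hρΩ).add ?_
    fun_prop
  have hbdry : ∀ x, dist x z = ρ → w x ≤ w z := by
    intro x hx
    have hxΩ : x ∈ Ω := hρΩ (Metric.mem_closedBall.2 hx.le)
    simp only [hw]
    rw [hzM', hzy']
    by_cases hxR : ‖x - y'‖ ≤ R
    · have h1 := hεT x hx hxR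
      have h2 : Real.exp (-α * ‖x - y'‖ ^ 2) ≤ 1 := by
        rw [Real.exp_le_one_iff]
        have : 0 ≤ α * ‖x - y'‖ ^ 2 := by positivity
        linarith
      have h3 : 0 ≤ ε * Real.exp (-α * R ^ 2) := by positivity
      have h4 := mul_le_mul_of_nonneg_left h2 hε.le
      linarith
    · push Not at hxR
      have h2 : Real.exp (-α * ‖x - y'‖ ^ 2) ≤ Real.exp (-α * R ^ 2) := by
        rw [Real.exp_le_exp]
        have : α * R ^ 2 ≤ α * ‖x - y'‖ ^ 2 := by gcongr
        linarith
      have h4 := mul_le_mul_of_nonneg_left h2 hε.le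
      have := hle x hxΩ
      linarith
  obtain ⟨p, hpb, hpmax⟩ : ∃ p ∈ Metric.ball z ρ, IsMaxOn w (Metric.closedBall z ρ) p := by
    obtain ⟨p, hp, hpm⟩ := (isCompact_closedBall z ρ).exists_isMaxOn
      ⟨z, Metric.mem_closedBall_self hρ.le⟩ hwc
    rcases lt_or_eq_of_le (Metric.mem_closedBall.1 hp) with h | h
    · exact ⟨p, h, hpm⟩
    · exact ⟨z, Metric.mem_ball_self hρ, fun x hx => le_trans (hpm hx) (hbdry p h)⟩
  have hpl : IsLocalMax w p :=
    hpmax.isLocalMax (Filter.mem_of_superset (Metric.isOpen_ball.mem_nhds hpb)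
      Metric.ball_subset_closedBall)
  have hpΩ : p ∈ Ω := hρΩ (Metric.ball_subset_closedBall hpb)
  have key := smp_local n Ω hΩopen u Du D2u hDu hD2u a b K hK ha_bd hb_bd lam hlam hell hLu
    p y' hpΩ ε α hε hα0 hpl
  rw [Metric.mem_ball, dist_eq_norm] at hpb
  have hlow : R / 2 ≤ ‖p - y'‖ := by
    have := norm_sub_le_norm_sub_add_norm_sub z p y'
    rw [norm_sub_rev z p] at this
    linarith
  have hup : ‖p - y'‖ ≤ 2 * R := by
    have := norm_sub_le_norm_sub_add_norm_sub p z y'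
    linarith
  have h1 : 2 * α * lam * (R / 2) ^ 2 ≤ 2 * α * lam * ‖p - y'‖ ^ 2 := by gcongr
  have h2 : 2 * α * lam * (R / 2) ^ 2 = n * K * (1 + 2 * R) + 1 := by
    rw [hα]; field_simp
  have h3 : n * K * (1 + ‖p - y'‖) ≤ n * K * (1 + 2 * R) := by gcongr
  linarith
end

section
/- Hopf boundary point lemma: Let Ω ⊆ E = EuclideanSpace ℝ (Fin n) be a nonempty bounded open set, let u : E → ℝ be continuous on the closure of Ω and C² on Ω with data (Du, D²u), let the coefficients a, b, c be bounded on Ω with c(x) ≤ 0 for all x ∈ Ω, let L be uniformly elliptic on Ω, and suppose Lu(x) ≥ 0 for all x ∈ Ω. Let x₀ ∈ frontier Ω be such that: (I) u is continuous at x₀ (within the closure of Ω); (II) u(x₀) ≥ 0; (III) u(x₀) > u(x) for all x ∈ Ω; (IV) there exist y ∈ Ω and r > 0 with the open ball B(y,r) contained in Ω and ‖x₀ − y‖ = r. Set ν = (x₀ − y)/r (the outer normal of the ball at x₀). If the one-sided normal derivative exists, i.e. the map s ↦ u(x₀ + s•ν) has derivative d at s = 0 within (−∞,0], then d > 0. 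-/
section HopfAux
open Set Filter Topology

lemma second_deriv_nonpos {f f' : ℝ → ℝ} {f'' : ℝ} (h1 : ∀ᶠ t in 𝓝 (0:ℝ), HasDerivAt f (f' t) t)
    (h2 : HasDerivAt f' f'' 0) (hm : IsLocalMax f 0) : f'' ≤ 0 := by
  by_contra! hpos
  have e1 : deriv f =ᶠ[𝓝 0] f' := h1.mono fun t ht => ht.deriv
  have e2 : deriv (deriv f) 0 = f'' := by rw [e1.deriv_eq, h2.deriv]
  have hmin := isLocalMin_of_deriv_deriv_pos (f := f) (x₀ := 0) (by rw [e2]; exact hpos)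
    hm.deriv_eq_zero h1.self_of_nhds.continuousAt
  have e3 : f =ᶠ[𝓝 0] fun _ => f 0 := by
    filter_upwards [hm, hmin] with t h h'
    exact le_antisymm h h'
  have e4 : deriv f =ᶠ[𝓝 0] fun _ => 0 := by
    filter_upwards [e3.eventually_nhds] with t ht
    rw [Filter.EventuallyEq.deriv_eq (f₁ := f) (f := fun _ => f 0) ht]; simp
  rw [e4.deriv_eq] at e2
  simp at e2
  linarith

lemma hess_nonpos {E : Type*} [NormedAddCommGroup E] [NormedSpace ℝ E] {w : E → ℝ}
    {Dw : E → E →L[ℝ] ℝ} {H : E →L[ℝ] E →L[ℝ] ℝ} {x : E}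
    (h1 : ∀ᶠ z in 𝓝 x, HasFDerivAt w (Dw z) z) (h2 : HasFDerivAt Dw H x)
    (hm : IsLocalMax w x) (ξ : E) : H ξ ξ ≤ 0 := by
  have hl : ∀ t : ℝ, HasDerivAt (fun t : ℝ => x + t • ξ) ξ t := fun t => by
    simpa using ((hasDerivAt_id t).smul_const ξ).const_add x
  have hc : Tendsto (fun t : ℝ => x + t • ξ) (𝓝 0) (𝓝 x) := by
    simpa using (hl 0).continuousAt.tendsto
  refine second_deriv_nonpos (f := fun t => w (x + t • ξ)) (f' := fun t => Dw (x + t • ξ) ξ) ?_ ?_ ?_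
  · filter_upwards [hc.eventually h1] with t ht
    exact ht.comp_hasDerivAt t (hl t)
  · have h2' : HasFDerivAt Dw H (x + (0:ℝ) • ξ) := by simpa using h2
    have h3 : HasFDerivAt (fun z => Dw z ξ) ((ContinuousLinearMap.apply ℝ ℝ ξ).comp H)
        (x + (0:ℝ) • ξ) := (ContinuousLinearMap.apply ℝ ℝ ξ).hasFDerivAt.comp _ h2'
    exact h3.comp_hasDerivAt (0:ℝ) (hl 0)
  · have := hc.eventually hm
    simpa [IsLocalMax, IsMaxFilter] using this

lemma trace_nonpos {n : ℕ} (a : Fin n → Fin n → ℝ)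
    (ha : ∀ ξ : EuclideanSpace ℝ (Fin n), 0 ≤ ∑ i, ∑ j, a i j * ξ i * ξ j)
    (H : EuclideanSpace ℝ (Fin n) →L[ℝ] (EuclideanSpace ℝ (Fin n) →L[ℝ] ℝ))
    (hs : ∀ v w, H v w = H w v) (hn : ∀ v, H v v ≤ 0) :
    ∑ i, ∑ j, a i j * H (EuclideanSpace.single i 1) (EuclideanSpace.single j 1) ≤ 0 := by
  let M : Matrix (Fin n) (Fin n) ℝ :=
    Matrix.of fun i j => - H (EuclideanSpace.single i 1) (EuclideanSpace.single j 1)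
  have hM : M.PosSemidef := by
    refine .of_dotProduct_mulVec_nonneg ?_ fun v => ?_
    · ext i j; simp [M, hs]
    · have hv : (WithLp.toLp 2 v : EuclideanSpace ℝ (Fin n)) = ∑ i, v i • EuclideanSpace.single i (1:ℝ) := by
        ext j
        simp [Finset.sum_apply, Pi.single_apply]
      have := hn (WithLp.toLp 2 v)
      rw [hv] at this
      simp only [map_sum, map_smul, sum_apply, smul_apply, smul_eq_mul] at this
      have e : star v ⬝ᵥ M.mulVec v = - ∑ x, v x * ∑ y, v y * H (EuclideanSpace.single y 1) (EuclideanSpace.single x 1) := by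
        simp only [dotProduct, Matrix.mulVec, M, Matrix.of_apply, Pi.star_apply, star_trivial, ← Finset.sum_neg_distrib, Finset.mul_sum]
        refine Finset.sum_congr rfl fun i _ => Finset.sum_congr rfl fun j _ => ?_
        rw [hs]; ring
      rw [e]; linarith
  obtain ⟨m, B, hB⟩ := Matrix.posSemidef_iff_eq_sum_vecMulVec.mp hM
  have key : ∀ i j, H (EuclideanSpace.single i 1) (EuclideanSpace.single j 1) = - ∑ k, B k i * B k j := by
    intro i j
    have := congrFun (congrFun hB i) j
    simp [M, Matrix.sum_apply, Matrix.vecMulVec_apply] at this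
    linarith
  have : ∑ i, ∑ j, a i j * H (EuclideanSpace.single i 1) (EuclideanSpace.single j 1)
      = - ∑ k, ∑ i, ∑ j, a i j * B k i * B k j := by
    simp only [key, mul_neg, Finset.sum_neg_distrib, Finset.mul_sum]
    congr 1
    conv_rhs => rw [Finset.sum_comm]
    refine Finset.sum_congr rfl fun i _ => ?_
    conv_rhs => rw [Finset.sum_comm]
    refine Finset.sum_congr rfl fun j _ => Finset.sum_congr rfl fun k _ => by ring
  rw [this]
  have := Finset.sum_nonneg fun k (_ : k ∈ Finset.univ) => ha (WithLp.toLp 2 (B k))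
  simp at this ⊢
  exact this

noncomputable section
variable {n : ℕ}
local notation "V" => EuclideanSpace ℝ (Fin n)

lemma barrier_fderiv (α : ℝ) (y x : V) :
    HasFDerivAt (fun x : V => Real.exp (-α * ‖x - y‖^2))
      ((-2 * α * Real.exp (-α * ‖x - y‖^2)) • innerSL ℝ (x - y)) x := by
  have h := ((((hasFDerivAt_id x).sub_const y).norm_sq).const_mul (-α)).exp
  refine h.congr_fderiv ?_
  ext ξ
  simp
  ring

lemma barrier_fderiv2 (α : ℝ) (y x : V) :
    ∃ H : V →L[ℝ] V →L[ℝ] ℝ,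
    HasFDerivAt (fun x : V => (-2 * α * Real.exp (-α * ‖x - y‖^2)) • innerSL ℝ (x - y)) H x ∧
    ∀ ξ η, H ξ η = Real.exp (-α * ‖x - y‖^2) *
      (4 * α^2 * inner ℝ (x-y) ξ * inner ℝ (x-y) η - 2 * α * inner ℝ ξ η) := by
  have h1 := (barrier_fderiv α y x).const_mul (-2 * α)
  have h2 : HasFDerivAt (fun x : V => innerSL ℝ (x - y)) (innerSL ℝ : V →L[ℝ] V →L[ℝ] ℝ) x :=
    (innerSL ℝ : V →L[ℝ] V →L[ℝ] ℝ).hasFDerivAt.comp x ((hasFDerivAt_id x).sub_const y)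
  refine ⟨_, h1.smul h2, fun ξ η => ?_⟩
  have e : (innerSL ℝ : V →L[ℝ] V →L[ℝ] ℝ) ξ η = inner ℝ ξ η := rfl
  simp only [add_apply, smul_apply, ContinuousLinearMap.smulRight_apply, smul_eq_mul, e, innerSL_apply_apply]
  ring

lemma barrier_pos (a : Fin n → Fin n → ℝ) (b : Fin n → ℝ) (c K lam ρ r α e v : ℝ) (z : V)
    (hK : 0 < K) (ha : ∀ i j, |a i j| ≤ K) (hb : ∀ i, |b i| ≤ K) (hc : |c| ≤ K) (hlam : 0 < lam)
    (hell : lam * ‖z‖ ^ 2 ≤ ∑ i, ∑ j, a i j * z i * z j) (hρ : 0 < ρ) (hz : ρ ≤ ‖z‖) (hz' : ‖z‖ ≤ r)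
    (hα : 0 < α) (hαq : 0 < 4 * α^2 * (lam * ρ^2) - 2 * α * (n * K) - 2 * α * (n * (K * r)) - K)
    (he : 0 < e) (hv : 0 ≤ v) (hve : v ≤ e) :
    0 < (∑ i, ∑ j, a i j * (e * (4 * α^2 * inner ℝ z (EuclideanSpace.single i (1:ℝ))
            * inner ℝ z (EuclideanSpace.single j (1:ℝ))
          - 2 * α * inner ℝ (EuclideanSpace.single i (1:ℝ) : V) (EuclideanSpace.single j (1:ℝ)))))
      + (∑ i, b i * (-2 * α * e * inner ℝ z (EuclideanSpace.single i (1:ℝ)))) + c * v := by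
  have e1 : (∑ i, ∑ j, a i j * (e * (4 * α^2 * inner ℝ z (EuclideanSpace.single i (1:ℝ))
            * inner ℝ z (EuclideanSpace.single j (1:ℝ))
          - 2 * α * inner ℝ (EuclideanSpace.single i (1:ℝ) : V) (EuclideanSpace.single j (1:ℝ)))))
      = e * (4 * α^2 * (∑ i, ∑ j, a i j * z i * z j) - 2 * α * ∑ i, a i i) := by
    have : ∀ i, a i i = ∑ j, if i = j then a i j else 0 := fun i => by simp
    simp only [this, Finset.mul_sum, ← Finset.sum_sub_distrib]
    refine Finset.sum_congr rfl fun i _ => Finset.sum_congr rfl fun j _ => ?_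
    by_cases h : i = j
    · subst h; simp [EuclideanSpace.inner_single_right]; ring
    · simp [EuclideanSpace.inner_single_right, h, Ne.symm h]; ring
  have e2 : (∑ i, b i * (-2 * α * e * inner ℝ z (EuclideanSpace.single i (1:ℝ))))
      = - (2 * α * e * ∑ i, b i * z i) := by
    simp only [Finset.mul_sum, ← Finset.sum_neg_distrib]
    refine Finset.sum_congr rfl fun i _ => ?_
    simp [EuclideanSpace.inner_single_right]; ring
  have b1 : ∑ i, a i i ≤ n * K := by
    simpa using Finset.sum_le_card_nsmul Finset.univ (fun i => a i i) K fun i _ => (abs_le.1 (ha i i)).2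
  have b2 : ∑ i, b i * z i ≤ n * (K * r) := by
    simpa using Finset.sum_le_card_nsmul Finset.univ (fun i => b i * z i) (K * r) fun i _ => by
      refine (le_abs_self _).trans ?_
      rw [abs_mul]
      have : |z i| ≤ ‖z‖ := PiLp.norm_apply_le z i
      exact mul_le_mul (hb i) (this.trans hz') (abs_nonneg _) hK.le
  have b3 : -(K * e) ≤ c * v := by
    have := (abs_le.1 hc).1
    nlinarith
  have b4 : lam * ρ^2 ≤ ∑ i, ∑ j, a i j * z i * z j := by
    refine le_trans ?_ hell
    gcongr
  rw [e1, e2]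
  have t1 : 4 * α^2 * (lam * ρ^2) ≤ 4 * α^2 * ∑ i, ∑ j, a i j * z i * z j := by gcongr
  have t2 : 2 * α * ∑ i, a i i ≤ 2 * α * (n * K) := by gcongr
  have t3 : 2 * α * ∑ i, b i * z i ≤ 2 * α * (n * (K * r)) := by gcongr
  have t4 : 0 < e * (4 * α^2 * (∑ i, ∑ j, a i j * z i * z j) - 2 * α * (∑ i, a i i)
      - 2 * α * (∑ i, b i * z i) - K) := mul_pos he (by linarith)
  nlinarith

lemma deriv_nonneg_of_max {g : ℝ → ℝ} {g' : ℝ} (h : HasDerivWithinAt g g' (Set.Iic 0) 0)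
    (hm : ∀ᶠ s in 𝓝[<] (0:ℝ), g s ≤ g 0) : 0 ≤ g' := by
  have h1 := h.mono Iio_subset_Iic_self
  rw [hasDerivWithinAt_iff_tendsto_slope' (by simp)] at h1
  refine ge_of_tendsto h1 ?_
  filter_upwards [hm, self_mem_nhdsWithin] with s hs hs'
  rw [slope_def_field]
  exact div_nonneg_of_nonpos (by linarith) (by simpa using (le_of_lt hs'))
end
end HopfAux

open Set

/-- Hopf boundary point lemma: suppose `Lu ≥ 0` on a nonempty bounded open set
`Ω` with `c ≤ 0`, `L` uniformly elliptic with bounded coefficients, and `u`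
continuous on `closure Ω` and `C²` on `Ω`. Let `x₀ ∈ ∂Ω` with `u` continuous
at `x₀` (within `closure Ω`), `u x₀ ≥ 0`, `u x₀ > u x` for all `x ∈ Ω`, and
suppose there is an open ball `B(y,r) ⊆ Ω` with `x₀` on its boundary. If the
one-sided derivative `d` of `s ↦ u (x₀ + s • ν)` at `0` (within `(-∞,0]`)
exists, where `ν = (x₀ - y)/r` is the outer normal, then `d > 0`. -/
theorem hopf_boundary_point_lemma (n : ℕ)
    (Ω : Set (EuclideanSpace ℝ (Fin n)))
    (hΩne : Ω.Nonempty) (hΩopen : IsOpen Ω) (hΩbd : Bornology.IsBounded Ω)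
    (u : EuclideanSpace ℝ (Fin n) → ℝ)
    (Du : EuclideanSpace ℝ (Fin n) → (EuclideanSpace ℝ (Fin n) →L[ℝ] ℝ))
    (D2u : EuclideanSpace ℝ (Fin n) →
      (EuclideanSpace ℝ (Fin n) →L[ℝ] (EuclideanSpace ℝ (Fin n) →L[ℝ] ℝ)))
    (hu_cont : ContinuousOn u (closure Ω))
    (hDu : ∀ x ∈ Ω, HasFDerivAt u (Du x) x)
    (hD2u : ∀ x ∈ Ω, HasFDerivAt Du (D2u x) x)
    (a : Fin n → Fin n → EuclideanSpace ℝ (Fin n) → ℝ)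
    (b : Fin n → EuclideanSpace ℝ (Fin n) → ℝ)
    (c : EuclideanSpace ℝ (Fin n) → ℝ)
    (K : ℝ) (hK : 0 < K)
    (ha_bd : ∀ i j, ∀ x ∈ Ω, |a i j x| ≤ K)
    (hb_bd : ∀ i, ∀ x ∈ Ω, |b i x| ≤ K)
    (hc_bd : ∀ x ∈ Ω, |c x| ≤ K)
    (hc_nonpos : ∀ x ∈ Ω, c x ≤ 0)
    (lam : ℝ) (hlam : 0 < lam)
    (hell : ∀ x ∈ Ω, ∀ ξ : EuclideanSpace ℝ (Fin n),
      lam * ‖ξ‖ ^ 2 ≤ ∑ i, ∑ j, a i j x * ξ i * ξ j)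
    (hLu : ∀ x ∈ Ω,
      0 ≤ (∑ i, ∑ j, a i j x *
            D2u x (EuclideanSpace.single i 1) (EuclideanSpace.single j 1)) +
          (∑ i, b i x * Du x (EuclideanSpace.single i 1)) + c x * u x)
    (x₀ : EuclideanSpace ℝ (Fin n)) (hx₀ : x₀ ∈ frontier Ω)
    (hI : ContinuousWithinAt u (closure Ω) x₀)
    (hII : 0 ≤ u x₀)
    (hIII : ∀ x ∈ Ω, u x < u x₀)
    (y : EuclideanSpace ℝ (Fin n)) (hy : y ∈ Ω) (r : ℝ) (hr : 0 < r)
    (hball : Metric.ball y r ⊆ Ω) (hxr : ‖x₀ - y‖ = r)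
    (d : ℝ)
    (hd : HasDerivWithinAt (fun s : ℝ => u (x₀ + s • ((1 / r) • (x₀ - y))))
      d (Set.Iic 0) 0) :
    0 < d := by
  classical
  -- choice of parameters
  obtain ⟨ρ, hρdef⟩ : ∃ ρ, ρ = r / 2 := ⟨_, rfl⟩
  have hρ : 0 < ρ := by rw [hρdef]; positivity
  have hρr : ρ < r := by rw [hρdef]; linarith
  obtain ⟨α, hα, hαq⟩ : ∃ α : ℝ, 0 < α ∧
      0 < 4 * α^2 * (lam * ρ^2) - 2 * α * (n * K) - 2 * α * (n * (K * r)) - K := by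
    have hA : 0 < 4 * (lam * ρ^2) := by positivity
    have hB : 0 ≤ 2 * (n * K) + 2 * (n * (K * r)) := by positivity
    generalize hAe : 4 * (lam * ρ^2) = A at hA
    generalize hBe : 2 * (n * K) + 2 * (n * (K * r)) = B at hB
    have hq : 0 ≤ (B + K) / A := by positivity
    refine ⟨(B + K) / A + 1, by linarith, ?_⟩
    have h1 : A * ((B + K) / A + 1) = B + K + A := by field_simp
    generalize (B + K) / A + 1 = α at h1 hq
    have h2 : 1 ≤ α := by
      by_contra! h; nlinarith
    have : 4 * α^2 * (lam * ρ^2) - 2 * α * (n * K) - 2 * α * (n * (K * r)) - K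
        = α * (A * α - B) - K := by rw [← hAe, ← hBe]; ring
    rw [this, h1]
    nlinarith
  have hcl : Metric.closedBall y r ⊆ closure Ω := by
    rw [← closure_ball y hr.ne']; exact closure_mono hball
  have hle : ∀ x ∈ closure Ω, u x ≤ u x₀ := fun x hx =>
    le_on_closure (f := u) (g := fun _ => u x₀) (fun z hz => (hIII z hz).le) hu_cont
      continuousOn_const hx
  have hsub : Metric.closedBall y ρ ⊆ Ω := (Metric.closedBall_subset_ball hρr).trans hball
  obtain ⟨xm, hxm, hxmax⟩ := (isCompact_closedBall y ρ).exists_isMaxOn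
    ⟨y, Metric.mem_closedBall_self hρ.le⟩ (hu_cont.mono (hsub.trans subset_closure))
  obtain ⟨ε, hεdef⟩ : ∃ ε, ε = u x₀ - u xm := ⟨_, rfl⟩
  have hε : 0 < ε := by rw [hεdef]; linarith [hIII xm (hsub hxm)]
  -- the comparison function
  let v : EuclideanSpace ℝ (Fin n) → ℝ := fun x => Real.exp (-α * ‖x - y‖^2) - Real.exp (-α * r^2)
  let w : EuclideanSpace ℝ (Fin n) → ℝ := fun x => u x - u x₀ + ε * v x
  have hv_nonneg : ∀ x, ‖x - y‖ ≤ r → 0 ≤ v x := by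
    intro x hx
    have : Real.exp (-α * r^2) ≤ Real.exp (-α * ‖x - y‖^2) := by
      apply Real.exp_le_exp.2
      have : ‖x - y‖^2 ≤ r^2 := by gcongr
      nlinarith
    simp only [v]; linarith
  have hv_le : ∀ x, v x ≤ Real.exp (-α * ‖x - y‖^2) := by
    intro x; have := Real.exp_pos (-α * r^2); simp only [v]; linarith
  have hv_le1 : ∀ x, v x ≤ 1 := by
    intro x
    refine (hv_le x).trans (Real.exp_le_one_iff.2 ?_)
    have : 0 ≤ α * ‖x - y‖^2 := by positivity
    linarith
  let A : Set (EuclideanSpace ℝ (Fin n)) := Metric.closedBall y r \ Metric.ball y ρ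
  have hAc : IsCompact A := (isCompact_closedBall y r).diff Metric.isOpen_ball
  have hx₀A : x₀ ∈ A := by
    refine ⟨?_, ?_⟩
    · rw [Metric.mem_closedBall, dist_eq_norm, hxr]
    · rw [Metric.mem_ball, dist_eq_norm, hxr]; exact hρr.not_gt
  have hwc : ContinuousOn w A := by
    have h1 : ContinuousOn u A := hu_cont.mono (Set.diff_subset.trans hcl)
    have h2 : Continuous v := by fun_prop
    exact (h1.sub continuousOn_const).add (h2.continuousOn.const_smul ε)
  obtain ⟨x, hxA, hxM⟩ := hAc.exists_isMaxOn ⟨x₀, hx₀A⟩ hwc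
  have hwx : w x ≤ 0 := by
    by_contra! hpos
    have hx1 : ‖x - y‖ ≤ r := by
      have := hxA.1; rwa [Metric.mem_closedBall, dist_eq_norm] at this
    have hx2 : ρ ≤ ‖x - y‖ := by
      have := hxA.2; rwa [Metric.mem_ball, dist_eq_norm, not_lt] at this
    have hx1' : ‖x - y‖ < r := by
      refine lt_of_le_of_ne hx1 fun h => ?_
      have : v x = 0 := by simp only [v, h, sub_self]
      have h2 := hle x (hcl hxA.1)
      simp only [w, this] at hpos
      linarith
    have hx2' : ρ < ‖x - y‖ := by
      refine lt_of_le_of_ne hx2 fun h => ?_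
      have h1 : u x ≤ u xm := hxmax (by
        show x ∈ Metric.closedBall y ρ
        rw [Metric.mem_closedBall, dist_eq_norm, ← h])
      have h2 := hv_le1 x
      simp only [w] at hpos
      nlinarith
    have hxΩ : x ∈ Ω := hball (by rwa [Metric.mem_ball, dist_eq_norm])
    have hnA : A ∈ nhds x := by
      have h1 : Metric.ball y r ∩ (Metric.closedBall y ρ)ᶜ ∈ nhds x :=
        (Metric.isOpen_ball.inter Metric.isClosed_closedBall.isOpen_compl).mem_nhds
          ⟨by rwa [Metric.mem_ball, dist_eq_norm],
           by rw [Set.mem_compl_iff, Metric.mem_closedBall, dist_eq_norm, not_le]; exact hx2'⟩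
      refine Filter.mem_of_superset h1 fun z hz => ⟨Metric.ball_subset_closedBall hz.1, fun h => hz.2 (Metric.ball_subset_closedBall h)⟩
    have hloc : IsLocalMax w x := hxM.isLocalMax hnA
    obtain ⟨H, hH, hHf⟩ := barrier_fderiv2 α y x
    let Dw : EuclideanSpace ℝ (Fin n) → (EuclideanSpace ℝ (Fin n) →L[ℝ] ℝ) := fun z =>
      Du z + ε • ((-2 * α * Real.exp (-α * ‖z - y‖^2)) • innerSL ℝ (z - y))
    have hDw : ∀ z ∈ Ω, HasFDerivAt w (Dw z) z := fun z hz =>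
      ((hDu z hz).sub_const _).add (((barrier_fderiv α y z).sub_const _).const_mul ε)
    have hDw' : ∀ᶠ z in nhds x, HasFDerivAt w (Dw z) z :=
      Filter.mem_of_superset (hΩopen.mem_nhds hxΩ) hDw
    have hD2w : HasFDerivAt Dw (D2u x + ε • H) x := (hD2u x hxΩ).add (hH.const_smul ε)
    have hD0 : Dw x = 0 := hloc.hasFDerivAt_eq_zero (hDw x hxΩ)
    have htr := trace_nonpos (fun i j => a i j x)
      (fun ξ => le_trans (by positivity) (hell x hxΩ ξ)) (D2u x + ε • H)
      (second_derivative_symmetric_of_eventually hDw' hD2w)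
      (hess_nonpos hDw' hD2w hloc)
    have hbp := barrier_pos (fun i j => a i j x) (fun i => b i x) (c x) K lam ρ r α
      (Real.exp (-α * ‖x - y‖^2)) (v x) (x - y) hK (fun i j => ha_bd i j x hxΩ)
      (fun i => hb_bd i x hxΩ) (hc_bd x hxΩ) hlam (hell x hxΩ _) hρ hx2 hx1 hα hαq
      (Real.exp_pos _) (hv_nonneg x hx1) (hv_le x)
    simp only [← hHf] at hbp
    have hL := hLu x hxΩ
    have hb0 : (∑ i, b i x * Du x (EuclideanSpace.single i 1)) + ε * (∑ i, b i x *
        (-2 * α * Real.exp (-α * ‖x - y‖^2) * inner ℝ (x - y) (EuclideanSpace.single i (1:ℝ)))) = 0 := by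
      rw [Finset.mul_sum, ← Finset.sum_add_distrib]
      refine Finset.sum_eq_zero fun i _ => ?_
      have h := congrArg (fun T : EuclideanSpace ℝ (Fin n) →L[ℝ] ℝ => T (EuclideanSpace.single i 1)) hD0
      simp only [Dw, add_apply, smul_apply, smul_eq_mul, innerSL_apply_apply, zero_apply] at h
      linear_combination b i x * h
    have htr' : (∑ i, ∑ j, a i j x *
            D2u x (EuclideanSpace.single i 1) (EuclideanSpace.single j 1)) +
        ε * (∑ i, ∑ j, a i j x *
            H (EuclideanSpace.single i 1) (EuclideanSpace.single j 1)) ≤ 0 := by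
      refine le_trans (le_of_eq ?_) htr
      simp only [Finset.mul_sum, ← Finset.sum_add_distrib]
      refine Finset.sum_congr rfl fun i _ => Finset.sum_congr rfl fun j _ => ?_
      simp only [add_apply, smul_apply, smul_eq_mul]
      ring
    have hcw : c x * w x ≤ 0 := mul_nonpos_of_nonpos_of_nonneg (hc_nonpos x hxΩ) hpos.le
    have hcu : c x * u x₀ ≤ 0 := mul_nonpos_of_nonpos_of_nonneg (hc_nonpos x hxΩ) hII
    have hcw' : c x * w x = c x * u x - c x * u x₀ + ε * (c x * v x) := by simp only [w]; ring
    have hbp' := mul_pos hε hbp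
    rw [mul_add, mul_add] at hbp'
    linarith
  have hwA : ∀ z ∈ A, w z ≤ 0 := fun z hz => (hxM hz).trans hwx
  -- one-dimensional conclusion
  have hder : HasDerivAt (fun s : ℝ => Real.exp (-α * (r + s)^2))
      (-(2 * α * r * Real.exp (-α * r^2))) 0 := by
    have h := ((((hasDerivAt_id (0:ℝ)).const_add r).pow 2).const_mul (-α)).exp
    refine h.congr_deriv ?_
    simp
    ring
  have hg := hd.add ((hder.const_mul ε).hasDerivWithinAt (s := Set.Iic 0))
  have hfin := deriv_nonneg_of_max hg (by
    have hmem : Set.Ioo (-ρ) 0 ∈ nhdsWithin (0:ℝ) (Set.Iio 0) :=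
      Ioo_mem_nhdsLT (by linarith)
    filter_upwards [hmem] with s hs
    have hnorm : ‖x₀ + s • ((1 / r) • (x₀ - y)) - y‖ = r + s := by
      have : x₀ + s • ((1 / r) • (x₀ - y)) - y = (1 + s / r) • (x₀ - y) := by
        rw [smul_smul, add_smul, one_smul, mul_one_div]; abel
      rw [this, norm_smul, hxr, Real.norm_eq_abs, abs_of_nonneg]
      · field_simp
      · have : 0 ≤ (r + s) / r := div_nonneg (by linarith [hs.1]) hr.le
        have h2 : (r + s) / r = 1 + s / r := by field_simp
        linarith
    have hz := hwA (x₀ + s • ((1 / r) • (x₀ - y))) ⟨by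
      rw [Metric.mem_closedBall, dist_eq_norm, hnorm]; linarith [hs.2], by
      rw [Metric.mem_ball, dist_eq_norm, hnorm, hρdef]; rw [hρdef] at hs; linarith [hs.1]⟩
    simp only [w, v, hnorm] at hz
    simp only [Pi.add_apply, zero_smul, add_zero]
    linarith)
  have : 0 < ε * (2 * α * r * Real.exp (-α * r^2)) := by positivity
  linarith
end

section
/- Weak maximum principle for parabolic equations, c ≡ 0: Let Ω ⊆ E = EuclideanSpace ℝ (Fin n) be a nonempty bounded open set, T > 0, and let u : ℝ × E → ℝ be admissible on Ω_T = Ω × (0,T] with data (∂ₜu, Du, D²u). Assume the coefficients a, b (with c ≡ 0) are bounded on (0,T] × Ω and the operator is parabolic with constant λ > 0. If A(u)(t,x) − ∂ₜu(t,x) ≥ 0 for all t ∈ (0,T] and x ∈ Ω, where A(u)(t,x) = ∑ᵢⱼ aᵢⱼ(t,x)∂ᵢ∂ⱼu(t,x) + ∑ᵢ bᵢ(t,x)∂ᵢu(t,x), then for every t ∈ [0,T] and every x in the closure of Ω, u(t,x) ≤ sSup of u over the parabolic boundary ∂ₚΩ_T = ([0,T] × frontier Ω) ∪ ({0} × closure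 Ω); i.e. the supremum of u over [0,T] × closure Ω equals its maximum over ∂ₚΩ_T. -/
open Set

open scoped MatrixOrder in
lemma wmp_factor {n : ℕ} (M : Matrix (Fin n) (Fin n) ℝ) (hM : M.PosSemidef) :
    ∃ B : Matrix (Fin n) (Fin n) ℝ, M = star B * B :=
  CStarAlgebra.nonneg_iff_eq_star_mul_self.mp hM.nonneg

lemma wmp_trace {n : ℕ} (a H : Fin n → Fin n → ℝ)
    (ha : ∀ ξ : Fin n → ℝ, 0 ≤ ∑ i, ∑ j, a i j * ξ i * ξ j)
    (hs : ∀ i j, H i j = H j i)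
    (hH : ∀ ξ : Fin n → ℝ, ∑ i, ∑ j, ξ i * (H i j * ξ j) ≤ 0) :
    ∑ i, ∑ j, a i j * H i j ≤ 0 := by
  obtain ⟨B, hB⟩ := wmp_factor (Matrix.of fun i j => - H i j) (by
    refine Matrix.PosSemidef.of_dotProduct_mulVec_nonneg ?_ ?_
    · ext i j
      simp [hs i j]
    · intro x
      have := hH x
      simp only [dotProduct, Matrix.mulVec, Finset.mul_sum, Pi.star_apply, star_trivial,
        Matrix.of_apply, neg_mul, mul_neg, Finset.sum_neg_distrib]
      linarith)
  have h1 : ∀ i j, H i j = - ∑ k, B k i * B k j := by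
    intro i j
    have := congrFun (congrFun hB i) j
    simp [Matrix.mul_apply, Matrix.star_apply] at this
    linarith
  have h2 : ∑ i, ∑ j, a i j * H i j = - ∑ k, ∑ i, ∑ j, a i j * B k i * B k j := by
    simp only [h1, mul_neg, Finset.mul_sum, Finset.sum_neg_distrib]
    congr 1
    rw [Finset.sum_comm (s := Finset.univ (α := Fin n)) (f := fun k i => ∑ j, a i j * B k i * B k j)]
    refine Finset.sum_congr rfl fun i _ => ?_
    rw [Finset.sum_comm]
    exact Finset.sum_congr rfl fun k _ => Finset.sum_congr rfl fun j _ => by ring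
  rw [h2]
  have : 0 ≤ ∑ k, ∑ i, ∑ j, a i j * B k i * B k j :=
    Finset.sum_nonneg fun k _ => ha (B k)
  linarith

lemma wmp_second {E : Type*} [NormedAddCommGroup E] [NormedSpace ℝ E] (f : E → ℝ)
    (f' : E → E →L[ℝ] ℝ) (f'' : E →L[ℝ] E →L[ℝ] ℝ) (x : E)
    (hf : ∀ᶠ y in nhds x, HasFDerivAt f (f' y) y) (hf' : HasFDerivAt f' f'' x)
    (hmax : IsLocalMax f x) (v : E) : f'' v v ≤ 0 := by
  by_contra! hpos
  let l : ℝ → E := fun s => x + s • v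
  have hl : ∀ s, HasDerivAt l v s := fun s => by
    have h := ((hasDerivAt_id s).smul_const v).const_add x
    rw [one_smul] at h
    exact h
  have l0 : l 0 = x := by simp [l]
  have lt : Filter.Tendsto l (nhds 0) (nhds x) := by
    have := (hl 0).continuousAt.tendsto
    rwa [l0] at this
  have hg : ∀ᶠ s in nhds (0:ℝ), HasDerivAt (f ∘ l) (f' (l s) v) s :=
    (lt.eventually hf).mono fun s hs => hs.comp_hasDerivAt s (hl s)
  have hg1 : deriv (f ∘ l) =ᶠ[nhds 0] fun s => f' (l s) v := hg.mono fun s hs => hs.deriv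
  have hg2 : HasDerivAt (fun s => f' (l s) v) (f'' v v) 0 := by
    have h1 : HasDerivAt (f' ∘ l) (f'' v) 0 :=
      HasFDerivAt.comp_hasDerivAt_of_eq 0 hf' (hl 0) l0.symm
    simpa using h1.clm_apply (hasDerivAt_const (0:ℝ) v)
  have hdd : deriv (deriv (f ∘ l)) 0 = f'' v v := by
    rw [hg1.deriv_eq, hg2.deriv]
  have hlmax : IsLocalMax (f ∘ l) 0 := by
    have := lt.eventually hmax
    filter_upwards [this] with s hs
    simpa [l0] using hs
  have hmin : IsLocalMin (f ∘ l) 0 :=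
    isLocalMin_of_deriv_deriv_pos (by rw [hdd]; exact hpos) hlmax.deriv_eq_zero
      hg.self_of_nhds.continuousAt
  have hc : (f ∘ l) =ᶠ[nhds 0] fun _ => (f ∘ l) 0 := by
    filter_upwards [hlmax, hmin] with s h1 h2
    exact le_antisymm h1 h2
  have : deriv (deriv (f ∘ l)) 0 = 0 := by
    rw [hc.deriv.deriv_eq]; simp
  linarith

/-- Weak maximum principle for parabolic equations, `c ≡ 0`: if
`A(u) - ∂ₜu ≥ 0` on the parabolic cylinder `Ω × (0,T]`, where
`A(u) = ∑ aᵢⱼ ∂ᵢ∂ⱼu + ∑ bᵢ ∂ᵢu` is parabolic with bounded coefficients and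
`u` is admissible, then the supremum of `u` over `[0,T] × closure Ω` is
attained on the parabolic boundary
`∂ₚΩ_T = ([0,T] × ∂Ω) ∪ ({0} × closure Ω)`. -/
theorem weak_maximum_principle_parabolic (n : ℕ)
    (Ω : Set (EuclideanSpace ℝ (Fin n)))
    (hΩne : Ω.Nonempty) (hΩopen : IsOpen Ω) (hΩbd : Bornology.IsBounded Ω)
    (T : ℝ) (hT : 0 < T)
    (u : ℝ × EuclideanSpace ℝ (Fin n) → ℝ)
    (ut : ℝ × EuclideanSpace ℝ (Fin n) → ℝ)
    (Du : ℝ × EuclideanSpace ℝ (Fin n) → (EuclideanSpace ℝ (Fin n) →L[ℝ] ℝ))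
    (D2u : ℝ × EuclideanSpace ℝ (Fin n) →
      (EuclideanSpace ℝ (Fin n) →L[ℝ] (EuclideanSpace ℝ (Fin n) →L[ℝ] ℝ)))
    (hu_cont : ContinuousOn u (Set.Icc 0 T ×ˢ closure Ω))
    (hut : ∀ t ∈ Set.Ioc 0 T, ∀ x ∈ Ω,
      HasDerivWithinAt (fun s => u (s, x)) (ut (t, x)) (Set.Ioc 0 T) t)
    (hDu : ∀ t ∈ Set.Ioc 0 T, ∀ x ∈ Ω,
      HasFDerivAt (fun y => u (t, y)) (Du (t, x)) x)
    (hD2u : ∀ t ∈ Set.Ioc 0 T, ∀ x ∈ Ω,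
      HasFDerivAt (fun y => Du (t, y)) (D2u (t, x)) x)
    (a : Fin n → Fin n → ℝ × EuclideanSpace ℝ (Fin n) → ℝ)
    (b : Fin n → ℝ × EuclideanSpace ℝ (Fin n) → ℝ)
    (K : ℝ) (hK : 0 < K)
    (ha_bd : ∀ i j, ∀ t ∈ Set.Ioc 0 T, ∀ x ∈ Ω, |a i j (t, x)| ≤ K)
    (hb_bd : ∀ i, ∀ t ∈ Set.Ioc 0 T, ∀ x ∈ Ω, |b i (t, x)| ≤ K)
    (lam : ℝ) (hlam : 0 < lam)
    (hpar : ∀ t ∈ Set.Ioc 0 T, ∀ x ∈ Ω, ∀ ξ : EuclideanSpace ℝ (Fin n),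
      lam * ‖ξ‖ ^ 2 ≤ ∑ i, ∑ j, a i j (t, x) * ξ i * ξ j)
    (hLu : ∀ t ∈ Set.Ioc 0 T, ∀ x ∈ Ω,
      0 ≤ (∑ i, ∑ j, a i j (t, x) *
            D2u (t, x) (EuclideanSpace.single i 1) (EuclideanSpace.single j 1)) +
          (∑ i, b i (t, x) * Du (t, x) (EuclideanSpace.single i 1)) -
          ut (t, x)) :
    ∀ t ∈ Set.Icc (0 : ℝ) T, ∀ x ∈ closure Ω,
      u (t, x) ≤
        sSup (u '' ((Set.Icc 0 T ×ˢ frontier Ω) ∪ ({0} ×ˢ closure Ω))) := by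
  intro t ht x hx
  set S := (Set.Icc 0 T ×ˢ frontier Ω) ∪ (({0} : Set ℝ) ×ˢ closure Ω) with hS
  have hcpt : IsCompact (Set.Icc (0:ℝ) T ×ˢ closure Ω) :=
    isCompact_Icc.prod hΩbd.isCompact_closure
  have hsub : S ⊆ Set.Icc (0:ℝ) T ×ˢ closure Ω := by
    rintro ⟨s, y⟩ (h | h)
    · exact ⟨h.1, frontier_subset_closure h.2⟩
    · obtain ⟨h1, h2⟩ := h
      simp only [Set.mem_singleton_iff] at h1
      exact ⟨by simp [h1, hT.le], h2⟩
  have hbdd : BddAbove (u '' S) :=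
    (hcpt.image_of_continuousOn hu_cont).bddAbove.mono (Set.image_mono hsub)
  have key : ∀ ε > 0, u (t, x) ≤ sSup (u '' S) + ε * T := by
    intro ε hε
    obtain ⟨⟨s, y⟩, hsy, hmax⟩ := hcpt.exists_isMaxOn ⟨(t, x), ht, hx⟩
      (f := fun p => u p - ε * p.1) (hu_cont.sub (by fun_prop))
    have hmem : (s, y) ∈ S := by
      by_contra hnot
      have hs0 : s ≠ 0 := fun h => hnot (Or.inr ⟨h, hsy.2⟩)
      have hs : s ∈ Set.Ioc 0 T := ⟨lt_of_le_of_ne hsy.1.1 hs0.symm, hsy.1.2⟩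
      have hy : y ∈ Ω := by
        by_contra h
        exact hnot (Or.inl ⟨hsy.1, by rw [hΩopen.frontier_eq]; exact ⟨hsy.2, h⟩⟩)
      have hΩn : Ω ∈ nhds y := hΩopen.mem_nhds hy
      have hlm : IsLocalMax (fun z => u (s, z)) y := by
        filter_upwards [hΩn] with z hz
        have := hmax (show (s, z) ∈ _ from ⟨hsy.1, subset_closure hz⟩)
        simpa using this
      have hev : ∀ᶠ z in nhds y, HasFDerivAt (fun y => u (s, y)) (Du (s, z)) z := by
        filter_upwards [hΩn] with z hz using hDu s hs z hz
      have hD0 : Du (s, y) = 0 := hlm.hasFDerivAt_eq_zero (hDu s hs y hy)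
      have hsec := wmp_second (fun z => u (s, z)) (fun z => Du (s, z)) (D2u (s, y)) y hev
        (hD2u s hs y hy) hlm
      have hsym := second_derivative_symmetric_of_eventually hev (hD2u s hs y hy)
      have htr := wmp_trace (fun i j => a i j (s, y)) (fun i j =>
        D2u (s, y) (EuclideanSpace.single i 1) (EuclideanSpace.single j 1))
        (fun ξ => le_trans (by positivity) (hpar s hs y hy (WithLp.toLp 2 ξ)))
        (fun i j => hsym _ _) (by
          intro ξ
          have h := hsec (∑ i, ξ i • EuclideanSpace.single i 1)
          simp only [map_sum, map_smul, ContinuousLinearMap.sum_apply,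
            ContinuousLinearMap.smul_apply, smul_eq_mul, Finset.mul_sum] at h
          refine le_trans (le_of_eq ?_) h
          refine Finset.sum_congr rfl fun i _ => Finset.sum_congr rfl fun j _ => ?_
          rw [hsym (EuclideanSpace.single j 1) (EuclideanSpace.single i 1)]
          ring)
      have htime : ε ≤ ut (s, y) := by
        have hd : HasDerivWithinAt (fun r => u (r, y) - ε * r) (ut (s, y) - ε) (Set.Ioc 0 T) s := by
          have h := (hut s hs y hy).sub ((hasDerivWithinAt_id s (Set.Ioc 0 T)).const_mul ε)
          rw [mul_one] at h
          exact h
        have hm : IsLocalMaxOn (fun r => u (r, y) - ε * r) (Set.Ioc 0 T) s := by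
          refine IsMaxOn.localize fun r hr => ?_
          exact hmax (show (r, y) ∈ _ from ⟨Set.Ioc_subset_Icc_self hr, hsy.2⟩)
        have hcone : s / 2 - s ∈ posTangentConeAt (Set.Ioc 0 T) s := by
          apply sub_mem_posTangentConeAt_of_segment_subset
          exact (convex_Ioc 0 T).segment_subset hs ⟨by linarith [hs.1], by linarith [hs.1, hs.2]⟩
        have := hm.hasFDerivWithinAt_nonpos hd.hasFDerivWithinAt hcone
        simp at this
        nlinarith [hs.1]
      have := hLu s hs y hy
      simp only [hD0, ContinuousLinearMap.zero_apply, mul_zero, Finset.sum_const_zero] at this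
      linarith
    have h1 := hmax (show (t, x) ∈ _ from ⟨ht, hx⟩)
    have h2 := le_csSup hbdd (Set.mem_image_of_mem u hmem)
    simp only [Set.mem_setOf_eq] at h1
    have h3 : ε * t ≤ ε * T := by gcongr; exact ht.2
    have h4 : 0 ≤ ε * s := mul_nonneg hε.le hsy.1.1
    linarith
  refine le_of_forall_pos_le_add fun δ hδ => ?_
  have := key (δ / T) (by positivity)
  rwa [div_mul_cancel₀ _ hT.ne'] at this
end
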